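/- There exists a real constant ρ_{τ,ε} (the random rotation number) such that for P-almost every ω ∈ Ω and for every x ∈ ℝ, the limit lim_{n→∞} (G^n_ω(x) − x)/n exists and equals ρ_{τ,ε}; in particular the limit is independent of both the initial point x and the noise realization ω. -/

import Mathlib

open MeasureTheory Real Filter Set Function

noncomputable section

/-- The lift `G_w(x) = x + τ + σ w − ε sin (2πx)` of the noisy Arnol'd circle map. -/
def Gmap (τ ε σ w : ℝ) (x : ℝ) : ℝ :=
  x + τ + σ * w - ε * Real.sin (2 * π * x)

/-- Iterated lifts `G^n_ω = G_{ω_{n−1}} ∘ ⋯ ∘ G_{ω_0}`. -/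
def Gn (τ ε σ : ℝ) (ω : ℤ → ℝ) : ℕ → ℝ → ℝ
  | 0 => id
  | n + 1 => Gmap τ ε σ (ω n) ∘ Gn τ ε σ ω n

/-- The uniform probability measure on `I = [−1/2, 1/2]`. -/
def nuI : Measure ℝ := volume.restrict (Icc (-(1/2) : ℝ) (1/2))

/-- `P` is the two-sided infinite product measure `ν^⊗ℤ` on `Ω = I^ℤ`, characterized by
its finite-dimensional marginals. -/
def IsProductNuZ (P : Measure (ℤ → ℝ)) : Prop :=
  IsProbabilityMeasure P ∧
    ∀ s : Finset ℤ, P.map (fun ω (i : s) => ω i) = Measure.pi (fun _ : s => nuI)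

lemma Gmap_mono (τ ε σ w : ℝ) (hε : 0 < ε) (hεπ : 2 * π * ε < 1) :
    Monotone (Gmap τ ε σ w) := by
  intro x y hxy
  unfold Gmap
  have h : |Real.sin (2 * π * y) - Real.sin (2 * π * x)| ≤ |2 * π * y - 2 * π * x| := by
    have := Real.lipschitzWith_sin.dist_le_mul (2 * π * y) (2 * π * x)
    simpa [Real.dist_eq] using this
  rw [show 2 * π * y - 2 * π * x = 2 * π * (y - x) by ring,
    abs_of_nonneg (mul_nonneg (by positivity) (sub_nonneg.2 hxy))] at h
  have h1 := (abs_le.1 h).2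
  have h2 := mul_le_mul_of_nonneg_left h1 hε.le
  have h3 := mul_le_mul_of_nonneg_right hεπ.le (sub_nonneg.2 hxy)
  nlinarith

lemma Gmap_add_int (τ ε σ w x : ℝ) (k : ℤ) :
    Gmap τ ε σ w (x + k) = Gmap τ ε σ w x + k := by
  unfold Gmap
  rw [show 2 * π * (x + k) = 2 * π * x + k * (2 * π) by ring, Real.sin_add_int_mul_two_pi]
  ring

lemma Gn_mono (τ ε σ : ℝ) (hε : 0 < ε) (hεπ : 2 * π * ε < 1) (ω : ℤ → ℝ) (n : ℕ) :
    Monotone (Gn τ ε σ ω n) := by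
  induction n with
  | zero => exact monotone_id
  | succ n ih => exact (Gmap_mono τ ε σ _ hε hεπ).comp ih

lemma Gn_add_int (τ ε σ : ℝ) (ω : ℤ → ℝ) (n : ℕ) (x : ℝ) (k : ℤ) :
    Gn τ ε σ ω n (x + k) = Gn τ ε σ ω n x + k := by
  induction n with
  | zero => rfl
  | succ n ih => simp only [Gn, Function.comp_apply, ih, Gmap_add_int]

lemma Gn_disp (τ ε σ : ℝ) (hε : 0 < ε) (hεπ : 2 * π * ε < 1) (ω : ℤ → ℝ) (n : ℕ) (x : ℝ) :
    |Gn τ ε σ ω n x - x - Gn τ ε σ ω n 0| ≤ 1 := by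
  have h1 := Int.floor_le x
  have h2 := (Int.lt_floor_add_one x).le
  have m1 := Gn_mono τ ε σ hε hεπ ω n h1
  have m2 := Gn_mono τ ε σ hε hεπ ω n h2
  have e1 := Gn_add_int τ ε σ ω n 0 ⌊x⌋
  have e2 := Gn_add_int τ ε σ ω n 0 (⌊x⌋ + 1)
  push_cast at e2
  rw [zero_add] at e1 e2
  rw [e1] at m1
  rw [e2] at m2
  rw [abs_le]
  constructor <;> linarith

/-- The shift of the noise. -/
def shiftN (a : ℕ) (ω : ℤ → ℝ) : ℤ → ℝ := fun i => ω (i + (a : ℤ))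

lemma Gn_add (τ ε σ : ℝ) (ω : ℤ → ℝ) (a b : ℕ) (x : ℝ) :
    Gn τ ε σ ω (a + b) x = Gn τ ε σ (shiftN a ω) b (Gn τ ε σ ω a x) := by
  induction b with
  | zero => rfl
  | succ b ih =>
    rw [← add_assoc]
    simp only [Gn, Function.comp_apply, ih, shiftN]
    congr 2
    push_cast
    ring

lemma Gn_congr (τ ε σ : ℝ) (ω ω' : ℤ → ℝ) (n : ℕ) (h : ∀ i : ℕ, i < n → ω i = ω' i) (x : ℝ) :
    Gn τ ε σ ω n x = Gn τ ε σ ω' n x := by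
  induction n with
  | zero => rfl
  | succ n ih =>
    simp only [Gn, Function.comp_apply]
    rw [ih (fun i hi => h i (by omega)), h n (by omega)]

lemma Gn_bound (τ ε σ : ℝ) (hε : 0 < ε) (hσ : 0 < σ) (ω : ℤ → ℝ)
    (hω : ∀ i, ω i ∈ Icc (-(1/2) : ℝ) (1/2)) (n : ℕ) (x : ℝ) :
    |Gn τ ε σ ω n x - x| ≤ n * (|τ| + σ + ε) := by
  induction n with
  | zero => simp [Gn]
  | succ n ih =>
    simp only [Gn, Function.comp_apply, Gmap]
    set y := Gn τ ε σ ω n x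
    have h1 := hω n
    have h2 := Real.neg_one_le_sin (2 * π * y)
    have h3 := Real.sin_le_one (2 * π * y)
    have h4 := neg_abs_le τ
    have h5 := le_abs_self τ
    have i1 : σ * ω n ≤ σ * 1 := mul_le_mul_of_nonneg_left (by linarith [h1.2]) hσ.le
    have i2 : σ * (-1) ≤ σ * ω n := mul_le_mul_of_nonneg_left (by linarith [h1.1]) hσ.le
    have i3 := mul_le_mul_of_nonneg_left h2 hε.le
    have i4 := mul_le_mul_of_nonneg_left h3 hε.le
    rw [abs_le] at ih ⊢
    push_cast
    constructor <;> linarith [ih.1, ih.2]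

lemma Gn_measurable (τ ε σ : ℝ) (n : ℕ) (x : ℝ) :
    Measurable (fun ω : ℤ → ℝ => Gn τ ε σ ω n x) := by
  induction n with
  | zero => exact measurable_const
  | succ n ih =>
    simp only [Gn, Function.comp_apply, Gmap]
    have : Measurable (fun ω : ℤ → ℝ => ω (n : ℤ)) := measurable_pi_apply _
    fun_prop

instance nuI_prob : IsProbabilityMeasure nuI := ⟨by
  simp only [nuI, Measure.restrict_apply_univ, Real.volume_Icc]
  norm_num⟩

lemma P_eq (P : Measure (ℤ → ℝ)) (hP : IsProductNuZ P) :
    P = Measure.infinitePi (fun _ : ℤ => nuI) :=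
  ((Measure.isProjectiveLimit_infinitePi (fun _ : ℤ => nuI)).unique (fun s => hP.2 s)).symm

/-- Block displacement. -/
def blk (τ ε σ : ℝ) (m j : ℕ) (ω : ℤ → ℝ) : ℝ := Gn τ ε σ (shiftN (m * j) ω) m 0

lemma shiftN_measurable (a : ℕ) : Measurable (shiftN a) := by
  unfold shiftN
  fun_prop

lemma blk_measurable (τ ε σ : ℝ) (m j : ℕ) : Measurable (blk τ ε σ m j) :=
  (Gn_measurable τ ε σ m 0).comp (shiftN_measurable _)

/-- Index set of a block. -/
def bset (m j : ℕ) : Finset ℤ := Finset.Ico ((m * j : ℕ) : ℤ) ((m * j + m : ℕ) : ℤ)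

open Classical in
/-- Extension by zero. -/
def ext0 (S : Finset ℤ) (v : S → ℝ) : ℤ → ℝ := fun i => if h : i ∈ S then v ⟨i, h⟩ else 0

lemma ext0_measurable (S : Finset ℤ) : Measurable (ext0 S) := by
  refine measurable_pi_lambda _ fun i => ?_
  unfold ext0
  by_cases h : i ∈ S
  · simp only [h, dite_true]
    exact measurable_pi_apply _
  · simp only [h, dite_false]
    exact measurable_const

lemma blk_ext (τ ε σ : ℝ) (m j : ℕ) :
    blk τ ε σ m j = (fun v => blk τ ε σ m j (ext0 (bset m j) v)) ∘ (fun ω (i : bset m j) => ω i) := by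
  funext ω
  simp only [Function.comp_apply, blk]
  refine Gn_congr _ _ _ _ _ _ (fun i hi => ?_) _
  have : (i : ℤ) + ((m * j : ℕ) : ℤ) ∈ bset m j := by
    simp only [bset, Finset.mem_Ico]
    push_cast
    constructor <;> omega
  simp only [shiftN, ext0, this, dite_true]

lemma bset_disj (m i j : ℕ) (h : i ≠ j) : Disjoint (bset m i) (bset m j) := by
  rw [Finset.disjoint_left]
  intro a ha hb
  simp only [bset, Finset.mem_Ico] at ha hb
  rcases lt_or_gt_of_ne h with h | h
  · have : m * i + m ≤ m * j := by nlinarith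
    omega
  · have : m * j + m ≤ m * i := by nlinarith
    omega

lemma blk_indep (τ ε σ : ℝ) (m i j : ℕ) (h : i ≠ j) :
    ProbabilityTheory.IndepFun (blk τ ε σ m i) (blk τ ε σ m j)
      (Measure.infinitePi (fun _ : ℤ => nuI)) := by
  have h0 : ProbabilityTheory.iIndepFun (fun (i : ℤ) (ω : ℤ → ℝ) => ω i)
      (Measure.infinitePi (fun _ : ℤ => nuI)) :=
    ProbabilityTheory.iIndepFun_infinitePi (X := fun _ x => x) (fun _ => measurable_id)
  have h1 := h0.indepFun_finset (bset m i) (bset m j) (bset_disj m i j h)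
    (fun i => measurable_pi_apply i)
  rw [blk_ext τ ε σ m i, blk_ext τ ε σ m j]
  exact h1.comp ((blk_measurable _ _ _ _ _).comp (ext0_measurable _))
    ((blk_measurable _ _ _ _ _).comp (ext0_measurable _))

lemma shiftN_map (a : ℕ) : (Measure.infinitePi (fun _ : ℤ => nuI)).map (shiftN a) =
    Measure.infinitePi (fun _ : ℤ => nuI) :=
  Measure.map_infinitePi_infinitePi_of_inj (P := fun _ : ℤ => nuI)
    (f := fun i : ℤ => i + (a : ℤ)) (add_left_injective _)

lemma blk_ident (τ ε σ : ℝ) (m j : ℕ) :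
    ProbabilityTheory.IdentDistrib (blk τ ε σ m j) (blk τ ε σ m 0)
      (Measure.infinitePi (fun _ : ℤ => nuI)) (Measure.infinitePi (fun _ : ℤ => nuI)) := by
  have key : ∀ j, (Measure.infinitePi (fun _ : ℤ => nuI)).map (blk τ ε σ m j) =
      (Measure.infinitePi (fun _ : ℤ => nuI)).map (fun ω => Gn τ ε σ ω m 0) := by
    intro j
    conv_rhs => rw [← shiftN_map (m * j)]
    rw [Measure.map_map (Gn_measurable _ _ _ _ _) (shiftN_measurable _)]
    rfl
  exact ⟨(blk_measurable _ _ _ _ _).aemeasurable, (blk_measurable _ _ _ _ _).aemeasurable,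
    (key j).trans (key 0).symm⟩

lemma ae_mem : ∀ᵐ ω ∂(Measure.infinitePi (fun _ : ℤ => nuI)),
    ∀ i, ω i ∈ Icc (-(1/2) : ℝ) (1/2) := by
  rw [ae_all_iff]
  intro i
  have h := (measurePreserving_eval_infinitePi (fun _ : ℤ => nuI) i).quasiMeasurePreserving
  have h1 : ∀ᵐ x ∂nuI, x ∈ Icc (-(1/2) : ℝ) (1/2) := ae_restrict_mem measurableSet_Icc
  exact h.ae h1

lemma blk_integrable (τ ε σ : ℝ) (hε : 0 < ε) (hσ : 0 < σ) (m j : ℕ) :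
    Integrable (blk τ ε σ m j) (Measure.infinitePi (fun _ : ℤ => nuI)) := by
  refine Integrable.of_bound (blk_measurable _ _ _ _ _).aestronglyMeasurable
    (m * (|τ| + σ + ε)) ?_
  filter_upwards [ae_mem] with ω hω
  have := Gn_bound τ ε σ hε hσ (shiftN (m * j) ω) (fun i => hω _) m 0
  simpa [blk, Real.norm_eq_abs] using this

lemma Gn_blocks (τ ε σ : ℝ) (hε : 0 < ε) (hεπ : 2 * π * ε < 1) (ω : ℤ → ℝ) (m k : ℕ) :
    |Gn τ ε σ ω (m * k) 0 - ∑ j ∈ Finset.range k, blk τ ε σ m j ω| ≤ k := by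
  induction k with
  | zero => simp [Gn]
  | succ k ih =>
    rw [mul_add, mul_one, Gn_add, Finset.sum_range_succ]
    have h := Gn_disp τ ε σ hε hεπ (shiftN (m * k) ω) m (Gn τ ε σ ω (m * k) 0)
    change |_ - _ - blk τ ε σ m k ω| ≤ 1 at h
    rw [abs_le] at *
    push_cast
    constructor <;> linarith [h.1, h.2, ih.1, ih.2]

lemma block_limit (τ ε σ : ℝ) (hε : 0 < ε) (hεπ : 2 * π * ε < 1) (hσ : 0 < σ) (m : ℕ)
    (hm : 0 < m) : ∃ a : ℝ, ∀ᵐ ω ∂(Measure.infinitePi (fun _ : ℤ => nuI)),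
      ∀ᶠ n : ℕ in atTop, |Gn τ ε σ ω n 0 / n - a| ≤ 2 / m := by
  have sl := ProbabilityTheory.strong_law_ae_real (blk τ ε σ m) (blk_integrable τ ε σ hε hσ m 0)
    (fun i j h => blk_indep τ ε σ m i j h) (blk_ident τ ε σ m)
  set E := ∫ ω, blk τ ε σ m 0 ω ∂(Measure.infinitePi (fun _ : ℤ => nuI)) with hE
  refine ⟨E / m, ?_⟩
  filter_upwards [sl, ae_mem] with ω h1 hω
  have hm' : (0 : ℝ) < m := by exact_mod_cast hm
  have h2 : ∀ᶠ k : ℕ in atTop,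
      |(∑ j ∈ Finset.range k, blk τ ε σ m j ω) / k - E| < 1 / 4 := by
    have := Metric.tendsto_nhds.1 h1 (1/4) (by norm_num)
    simpa [Real.dist_eq] using this
  have h3 := (Nat.tendsto_div_const_atTop hm.ne').eventually h2
  set C := |τ| + σ + ε with hC
  have hC0 : 0 ≤ C := by positivity
  have h4 : ∀ᶠ n : ℕ in atTop, (4 * m * (m * C + |E|) : ℝ) ≤ n :=
    tendsto_natCast_atTop_atTop.eventually_ge_atTop _
  filter_upwards [h3, h4, eventually_ge_atTop m] with n g3 g4 g5
  set k := n / m with hk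
  have hk0 : 0 < k := Nat.div_pos g5 hm
  have hk' : (0 : ℝ) < k := by exact_mod_cast hk0
  have hn' : (0 : ℝ) < n := by exact_mod_cast (lt_of_lt_of_le hm g5)
  have hdm : m * k + n % m = n := Nat.div_add_mod n m
  have hr : n % m < m := Nat.mod_lt n hm
  set r := n % m with hrr
  have hdm' : (m * k + r : ℝ) = n := by exact_mod_cast hdm
  have hr' : (r : ℝ) ≤ m := by exact_mod_cast hr.le
  have hr0 : (0 : ℝ) ≤ r := Nat.cast_nonneg r
  have b1 : |Gn τ ε σ ω n 0 - Gn τ ε σ ω (m * k) 0| ≤ m * C := by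
    have := Gn_bound τ ε σ hε hσ (shiftN (m * k) ω) (fun i => hω _) r (Gn τ ε σ ω (m * k) 0)
    rw [← Gn_add, hdm] at this
    exact this.trans (mul_le_mul_of_nonneg_right hr' hC0)
  have b2 := Gn_blocks τ ε σ hε hεπ ω m k
  set S := ∑ j ∈ Finset.range k, blk τ ε σ m j ω
  have b3 : |S - k * E| ≤ k / 4 := by
    have : S - k * E = (S / k - E) * k := by field_simp
    rw [this, abs_mul, abs_of_pos hk']
    nlinarith
  have b4 : |k * E - n * (E / m)| ≤ |E| := by
    have : k * E - n * (E / m) = - (r / m * E) := by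
      rw [← hdm']; field_simp; ring
    rw [this, abs_neg, abs_mul, abs_of_nonneg (by positivity)]
    exact mul_le_of_le_one_left (abs_nonneg _) ((div_le_one hm').2 hr')
  have b5 : (k : ℝ) ≤ n / m := by
    rw [le_div_iff₀ hm']; linarith
  have b6 : m * C + |E| ≤ n / m / 4 := by
    rw [div_div, le_div_iff₀ (by positivity)]; linarith
  have b7 : |Gn τ ε σ ω n 0 - n * (E / m)| ≤ 2 * (n / m) := by
    have hp : (0 : ℝ) < n / m := by positivity
    rw [abs_le] at b1 b2 b3 b4 ⊢
    constructor <;> linarith [b1.1, b1.2, b2.1, b2.2, b3.1, b3.2, b4.1, b4.2]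
  have : Gn τ ε σ ω n 0 / n - E / m = (Gn τ ε σ ω n 0 - n * (E / m)) / n := by
    field_simp
  rw [this, abs_div, abs_of_pos hn', div_le_iff₀ hn']
  calc _ ≤ _ := b7
    _ = _ := by ring

lemma limit_of_approx : ∀ (a : ℕ → ℝ),
    (∀ k l : ℕ, |a k - a l| ≤ 2 / ((k + 1 : ℕ) : ℝ) + 2 / ((l + 1 : ℕ) : ℝ)) →
    ∃ ρ, Tendsto a atTop (nhds ρ) := by
  intro a h
  apply cauchySeq_tendsto_of_complete
  have ht : Tendsto (fun N : ℕ => 4 * (1 / ((N : ℝ) + 1))) atTop (nhds 0) := by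
    simpa using (tendsto_one_div_add_atTop_nhds_zero_nat (𝕜 := ℝ)).const_mul 4
  refine cauchySeq_of_le_tendsto_0 (fun N : ℕ => 4 * (1 / ((N : ℝ) + 1))) ?_ ht
  intro n m N hn hm
  rw [Real.dist_eq]
  refine (h n m).trans ?_
  have hn' : (N : ℝ) ≤ n := by exact_mod_cast hn
  have hm' : (N : ℝ) ≤ m := by exact_mod_cast hm
  have h1 : 2 / ((n + 1 : ℕ) : ℝ) ≤ 2 / ((N : ℝ) + 1) := by
    push_cast
    gcongr
  have h2 : 2 / ((m + 1 : ℕ) : ℝ) ≤ 2 / ((N : ℝ) + 1) := by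
    push_cast
    gcongr
  calc _ ≤ _ := add_le_add h1 h2
    _ = _ := by ring

/-- **Existence of the random rotation number:** there is a constant `ρ` such that for
`P`-almost every noise realization `ω` and every `x ∈ ℝ`,
`(G^n_ω(x) − x)/n → ρ` as `n → ∞`; the limit is independent of both `x` and `ω`. -/
theorem noisy_circle_map_rotation_number (τ ε σ : ℝ)
    (hε : 0 < ε) (hεπ : 2 * π * ε < 1) (hσ : 0 < σ)
    (P : Measure (ℤ → ℝ)) (hP : IsProductNuZ P) :
    ∃ ρ : ℝ, ∀ᵐ ω ∂P, ∀ x : ℝ,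
      Tendsto (fun n : ℕ => (Gn τ ε σ ω n x - x) / n) atTop (nhds ρ) := by
  rw [P_eq P hP]
  choose a ha using fun k : ℕ => block_limit τ ε σ hε hεπ hσ (k + 1) k.succ_pos
  have hall := ae_all_iff.2 ha
  have hc : ∀ k l : ℕ, |a k - a l| ≤ 2 / ((k + 1 : ℕ) : ℝ) + 2 / ((l + 1 : ℕ) : ℝ) := by
    intro k l
    obtain ⟨ω, hω⟩ := hall.exists
    obtain ⟨n, h1, h2⟩ := ((hω k).and (hω l)).exists
    rw [abs_le] at *
    constructor <;> linarith [h1.1, h1.2, h2.1, h2.2]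
  obtain ⟨ρ, hρ⟩ := limit_of_approx a hc
  refine ⟨ρ, ?_⟩
  filter_upwards [hall] with ω hω x
  have h0 : Tendsto (fun n : ℕ => Gn τ ε σ ω n 0 / n) atTop (nhds ρ) := by
    rw [Metric.tendsto_nhds]
    intro δ hδ
    have ht : Tendsto (fun N : ℕ => 2 / ((N + 1 : ℕ) : ℝ)) atTop (nhds 0) := by
      have := (tendsto_one_div_add_atTop_nhds_zero_nat (𝕜 := ℝ)).const_mul 2
      simpa [div_eq_mul_inv] using this
    have e1 := (Metric.tendsto_nhds.1 hρ (δ / 2) (by positivity))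
    have e2 := ht.eventually_lt_const (show (0 : ℝ) < δ / 2 by positivity)
    obtain ⟨k, h1, h2⟩ := (e1.and e2).exists
    filter_upwards [hω k] with n hn
    rw [Real.dist_eq] at *
    rw [abs_lt] at *
    rw [abs_le] at hn
    constructor <;> linarith [h1.1, h1.2, hn.1, hn.2]
  have h1 : Tendsto (fun n : ℕ => (Gn τ ε σ ω n x - x - Gn τ ε σ ω n 0) / n) atTop (nhds 0) := by
    refine squeeze_zero_norm (fun n => ?_) (tendsto_one_div_atTop_nhds_zero_nat (𝕜 := ℝ))
    rw [Real.norm_eq_abs, abs_div, Nat.abs_cast]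
    exact div_le_div_of_nonneg_right (Gn_disp τ ε σ hε hεπ ω n x) (Nat.cast_nonneg n)
  have h2 := h1.add h0
  rw [zero_add] at h2
  refine h2.congr (fun n => ?_)
  rw [← add_div]
  ring
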